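/- arXiv:2109.07673 — 4 statements merged into one kernel-verified Lean document; each statement's English description precedes it below -/
import Mathlib

section
/- Let T be a finite horizon and a, b : ℕ → ℝ be sequences. Define V : ℕ → ℝ by the backward recursion V_T = max{b_T, a_T} and V_t = max{b_t, min{V_{t+1}, a_t}} for t < T. Then for every s ≤ T, V_s = min_{t ∈ {s,…,T}} max{a_t, max_{τ ∈ {s,…,t}} b_τ}; i.e., the backward dynamic-programming recursion used in the reach-avoid LQ solvers exactly computes the reach-avoid objective-to-go. -/
/-- Reach-avoid objective-to-go: J_s = min_{t∈{s,…,T}} max{a_t, max_{τ∈{s,…,t}} b_τ}. -/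
noncomputable def raJ (T : ℕ) (a b : ℕ → ℝ) (s : ℕ) (hs : s ≤ T) : ℝ :=
  (Finset.Icc s T).attach.inf'
    (Finset.attach_nonempty_iff.mpr (Finset.nonempty_Icc.mpr hs))
    fun t => max (a t.1)
      ((Finset.Icc s t.1).sup' (Finset.nonempty_Icc.mpr (Finset.mem_Icc.mp t.2).1) b)

theorem raJ_le_iff {T : ℕ} {a b : ℕ → ℝ} {s : ℕ} (hs : s ≤ T) (c : ℝ) :
    raJ T a b s hs ≤ c ↔
      ∃ t, s ≤ t ∧ t ≤ T ∧ a t ≤ c ∧ ∀ τ, s ≤ τ → τ ≤ t → b τ ≤ c := by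
  simp only [raJ, Finset.inf'_le_iff, Finset.mem_attach, true_and, Subtype.exists, max_le_iff,
    Finset.sup'_le_iff, Finset.mem_Icc, and_imp]
  grind

theorem backward_recursion_le_iff {T : ℕ} {a b V : ℕ → ℝ}
    (hVT : V T = max (b T) (a T))
    (hV : ∀ t, t < T → V t = max (b t) (min (V (t + 1)) (a t)))
    {s : ℕ} (hs : s ≤ T) (c : ℝ) :
    V s ≤ c ↔ ∃ t, s ≤ t ∧ t ≤ T ∧ a t ≤ c ∧ ∀ τ, s ≤ τ → τ ≤ t → b τ ≤ c := by
  induction hs using Nat.decreasingInduction with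
  | self =>
    rw [hVT, max_le_iff]
    constructor
    · rintro ⟨hb, ha⟩
      exact ⟨T, le_rfl, le_rfl, ha, fun τ h₁ h₂ => le_antisymm h₂ h₁ ▸ hb⟩
    · rintro ⟨t, h₁, h₂, ha, hb⟩
      obtain rfl := le_antisymm h₂ h₁
      exact ⟨hb _ le_rfl le_rfl, ha⟩
  | of_succ k hk ih =>
    rw [hV k hk, max_le_iff, min_le_iff, ih]
    constructor
    · rintro ⟨hbk, ⟨t, h₁, h₂, ha, hb⟩ | ha⟩
      · refine ⟨t, by lia, h₂, ha, fun τ h₃ h₄ => ?_⟩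
        rcases h₃.eq_or_lt with rfl | h₃
        · exact hbk
        · exact hb τ h₃ h₄
      · exact ⟨k, le_rfl, hk.le, ha, fun τ h₁ h₂ => le_antisymm h₂ h₁ ▸ hbk⟩
    · rintro ⟨t, h₁, h₂, ha, hb⟩
      refine ⟨hb k le_rfl h₁, ?_⟩
      rcases h₁.eq_or_lt with rfl | h₁
      · exact Or.inr ha
      · exact Or.inl ⟨t, h₁, h₂, ha, fun τ h₃ h₄ => hb τ (by lia) h₄⟩

/-- The backward dynamic-programming recursion `V_T = max{b_T, a_T}`,
`V_t = max{b_t, min{V_{t+1}, a_t}}` exactly computes the reach-avoid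
objective-to-go `J_s` for every `s ≤ T`. -/
theorem backward_recursion_computes_reach_avoid_objective
    (T : ℕ) (a b : ℕ → ℝ) (V : ℕ → ℝ)
    (hVT : V T = max (b T) (a T))
    (hV : ∀ t, t < T → V t = max (b t) (min (V (t + 1)) (a t))) :
    ∀ s (hs : s ≤ T), V s = raJ T a b s hs := by
  intro s hs
  exact eq_of_forall_ge_iff fun c =>
    (backward_recursion_le_iff hVT hV hs c).trans (raJ_le_iff hs c).symm
end

section
/- Let T be a finite horizon, a, b : ℕ → ℝ sequences, and V defined by V_T = max{b_T, a_T}, V_t = max{b_t, min{V_{t+1}, a_t}} for t < T. Call t critical if V_t = a_t or V_t = b_t, and let C ⊆ {0,…,T} denote the set of critical times. Then T ∈ C, and for every t ≤ T, letting τ(t) = min{t' ∈ C : t' ≥ t} (which exists), we have V_t = V_{τ(t)}; i.e., the objective-to-go at each time equals the margin value at the next critical time, as asserted in the critical-time decomposition J_t = m_{τ_j} for τ_{j−1} < t ≤ τ_j. -/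
/-- Critical-time decomposition: for the backward recursion
`V_T = max{b_T, a_T}`, `V_t = max{b_t, min{V_{t+1}, a_t}}`, let
`C = {t ≤ T : V_t = a_t ∨ V_t = b_t}` be the set of critical times.  Then `T ∈ C`,
and for every `t ≤ T` the least critical time `τ ≥ t` exists and satisfies
`V_t = V_τ`; i.e., the objective-to-go at each time equals the margin value at the
next critical time (`J_t = m_{τ_j}` for `τ_{j−1} < t ≤ τ_j`). -/
theorem reach_avoid_critical_time_decomposition
    (T : ℕ) (a b : ℕ → ℝ) (V : ℕ → ℝ)
    (hVT : V T = max (b T) (a T))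
    (hV : ∀ t, t < T → V t = max (b t) (min (V (t + 1)) (a t)))
    (C : Set ℕ) (hC : C = {t | t ≤ T ∧ (V t = a t ∨ V t = b t)}) :
    T ∈ C ∧
      ∀ t, t ≤ T → ∃ τ ∈ C, t ≤ τ ∧ (∀ τ' ∈ C, t ≤ τ' → τ ≤ τ') ∧ V t = V τ := by
  subst hC
  have hT : T ∈ {t | t ≤ T ∧ (V t = a t ∨ V t = b t)} :=
    ⟨le_rfl, hVT ▸ (max_choice (b T) (a T)).symm⟩
  refine ⟨hT, fun t ht => ?_⟩
  induction ht using Nat.decreasingInduction with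
  | self => exact ⟨T, hT, le_rfl, fun _ _ h => h, rfl⟩
  | of_succ t ht ih =>
    by_cases hc : V t = a t ∨ V t = b t
    · exact ⟨t, ⟨ht.le, hc⟩, le_rfl, fun _ _ h => h, rfl⟩
    · obtain ⟨τ, hτ, htτ, hmin, hVτ⟩ := ih
      have hstep : V t = V (t + 1) := by
        have := hV t ht
        rcases max_choice (b t) (min (V (t + 1)) (a t)) with h | h <;>
          rcases min_choice (V (t + 1)) (a t) with h' | h' <;> grind
      refine ⟨τ, hτ, by lia, fun τ' hτ' hle => hmin τ' hτ' ?_, hstep.trans hVτ⟩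
      refine Nat.succ_le_of_lt (lt_of_le_of_ne hle ?_)
      rintro rfl
      exact hc hτ'.2
end

section
/- Let X be a type, U a nonempty finite type, f : ℕ → X → U → X the dynamics, ℓ_t, g_t : X → ℝ margin functions, T a finite horizon, s ≤ T, and x ∈ X. Then the infimum of J_s over all feedback policies γ : ℕ → X → U (evaluated along the closed-loop trajectory from (s,x)) equals the infimum of J_s over all open-loop control sequences u_s,…,u_{T−1} ∈ U (evaluated along the corresponding trajectory from (s,x)), and both infima are attained; i.e., open-loop and feedback control achieve the same optimal reach-avoid value in this deterministic single-agent problem. -/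
/-- Open-loop trajectory: `x_s = x`, `x_{t+1} = f_t(x_t, u_t)` for `t ≥ s`. -/
def traj {X U : Type*} (f : ℕ → X → U → X) (u : ℕ → U) (s : ℕ) (x : X) (t : ℕ) : X :=
  Nat.rec (motive := fun _ => X) x (fun k xk => f (s + k) xk (u (s + k))) (t - s)

/-- Closed-loop trajectory under feedback policy `γ`:
`x_s = x`, `x_{t+1} = f_t(x_t, γ_t(x_t))` for `t ≥ s`. -/
def ctraj {X U : Type*} (f : ℕ → X → U → X) (γ : ℕ → X → U) (s : ℕ) (x : X) (t : ℕ) : X :=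
  Nat.rec (motive := fun _ => X) x (fun k xk => f (s + k) xk (γ (s + k) xk)) (t - s)

theorem raJ_congr {T s : ℕ} {a a' b b' : ℕ → ℝ} (hs : s ≤ T)
    (ha : ∀ t ≤ T, a t = a' t) (hb : ∀ t ≤ T, b t = b' t) :
    raJ T a b s hs = raJ T a' b' s hs := by
  refine Finset.inf'_congr _ rfl fun t _ => ?_
  have ht : t.1 ≤ T := (Finset.mem_Icc.mp t.2).2
  rw [ha t.1 ht]
  congr 1
  exact Finset.sup'_congr _ rfl fun τ hτ => hb τ ((Finset.mem_Icc.mp hτ).2.trans ht)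

theorem traj_eq_of_eqOn {X U : Type*} (f : ℕ → X → U → X) {u v : ℕ → U} {T : ℕ}
    (huv : ∀ t < T, u t = v t) {s : ℕ} (hs : s ≤ T) (x : X) {t : ℕ} (ht : t ≤ T) :
    traj f u s x t = traj f v s x t := by
  have key : ∀ n, s + n ≤ T →
      Nat.rec (motive := fun _ => X) x (fun k xk => f (s + k) xk (u (s + k))) n =
      Nat.rec (motive := fun _ => X) x (fun k xk => f (s + k) xk (v (s + k))) n := by
    intro n
    induction n with
    | zero => exact fun _ => rfl
    | succ n ih =>
      intro hn
      dsimp only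
      rw [ih (by omega), huv (s + n) (by omega)]
  exact key (t - s) (by omega)

/-- Playing the controls that a policy produces along its own trajectory reproduces it. -/
theorem traj_ctraj {X U : Type*} (f : ℕ → X → U → X) (γ : ℕ → X → U) (s : ℕ) (x : X) (t : ℕ) :
    traj f (fun k => γ k (ctraj f γ s x k)) s x t = ctraj f γ s x t := by
  unfold traj
  conv_rhs => unfold ctraj
  induction t - s with
  | zero => rfl
  | succ n ih =>
    dsimp only
    rw [ih]
    simp only [ctraj, Nat.add_sub_cancel_left]

/-- In the deterministic single-agent reach-avoid problem, open-loop and feedback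
control achieve the same optimal value: the minimum of `J_s` over feedback
policies and the minimum over open-loop control sequences exist, are attained,
and coincide. -/
theorem feedback_and_open_loop_reach_avoid_values_coincide
    {X U : Type*} [Fintype U] [Nonempty U]
    (f : ℕ → X → U → X) (ℓ g : ℕ → X → ℝ) (T : ℕ) (s : ℕ) (hs : s ≤ T) (x : X) :
    ∃ r : ℝ,
      IsLeast
        {r' : ℝ | ∃ γ : ℕ → X → U,
          r' = raJ T (fun t => ℓ t (ctraj f γ s x t)) (fun t => g t (ctraj f γ s x t)) s hs}
        r ∧
      IsLeast
        {r' : ℝ | ∃ u : ℕ → U,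
          r' = raJ T (fun t => ℓ t (traj f u s x t)) (fun t => g t (traj f u s x t)) s hs}
        r := by
  have hset : {r' : ℝ | ∃ γ : ℕ → X → U,
      r' = raJ T (fun t => ℓ t (ctraj f γ s x t)) (fun t => g t (ctraj f γ s x t)) s hs} =
      {r' : ℝ | ∃ u : ℕ → U,
        r' = raJ T (fun t => ℓ t (traj f u s x t)) (fun t => g t (traj f u s x t)) s hs} := by
    ext r
    constructor
    · rintro ⟨γ, rfl⟩
      exact ⟨fun k => γ k (ctraj f γ s x k), by simp only [traj_ctraj]⟩
    · rintro ⟨u, rfl⟩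
      exact ⟨fun t _ => u t, rfl⟩
  rw [hset]
  simp only [and_self]
  let extend (w : Fin T → U) (t : ℕ) : U :=
    if h : t < T then w ⟨t, h⟩ else Classical.arbitrary U
  let J (u : ℕ → U) : ℝ :=
    raJ T (fun t => ℓ t (traj f u s x t)) (fun t => g t (traj f u s x t)) s hs
  obtain ⟨w, hw⟩ := Finite.exists_min fun w => J (extend w)
  refine ⟨J (extend w), ⟨extend w, rfl⟩, ?_⟩
  rintro _ ⟨u, rfl⟩
  refine (hw fun i => u i).trans_eq ?_
  have hu : ∀ t < T, extend (fun i => u i) t = u t := fun t ht => dif_pos ht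
  exact raJ_congr hs (fun t ht => by rw [traj_eq_of_eqOn f hu hs x ht])
    fun t ht => by rw [traj_eq_of_eqOn f hu hs x ht]
end

section
/- Let (X, d) be a metric space, U a type, f : ℕ → X → U → X the dynamics, and γ*, γ : ℕ → X → U feedback policies whose closed-loop maps x ↦ f_t(x, γ*_t(x)) and x ↦ f_t(x, γ_t(x)) are continuous; let the margin functions ℓ_t, g_t : X → ℝ be continuous, T a finite horizon, s ≤ T, and x* ∈ X a state with J_s(x^{γ*}_{s,x*}) ≤ J_s(x^{γ}_{s,x*}). Then for every ε > 0 there exists δ > 0 such that for all x̃ with d(x̃, x*) < δ, J_s(x^{γ*}_{s,x̃}) ≤ J_s(x^{γ}_{s,x̃}) + ε; i.e., optimality of γ* against γ at x* implies the ε-near-optimality inequality of local strong time consistency on a δ-ball of initial states. -/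
theorem continuous_ctraj {X U : Type*} [TopologicalSpace X] {f : ℕ → X → U → X}
    {γ : ℕ → X → U} (hf : ∀ t, Continuous fun x => f t x (γ t x)) (s t : ℕ) :
    Continuous fun x => ctraj f γ s x t := by
  unfold ctraj
  induction t - s with
  | zero => exact continuous_id
  | succ k ih => exact (hf (s + k)).comp ih

theorem continuous_raJ {X : Type*} [TopologicalSpace X] {a b : X → ℕ → ℝ}
    (ha : ∀ t, Continuous fun x => a x t) (hb : ∀ t, Continuous fun x => b x t)
    (T s : ℕ) (hs : s ≤ T) : Continuous fun x => raJ T (a x) (b x) s hs := by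
  unfold raJ
  exact Continuous.finset_inf'_apply _ fun t _ =>
    (ha t.1).max (Continuous.finset_sup'_apply _ fun τ _ => hb τ)

theorem continuous_raJ_ctraj {X U : Type*} [TopologicalSpace X] {f : ℕ → X → U → X}
    {γ : ℕ → X → U} (hf : ∀ t, Continuous fun x => f t x (γ t x)) {ℓ g : ℕ → X → ℝ}
    (hℓ : ∀ t, Continuous (ℓ t)) (hg : ∀ t, Continuous (g t)) (T s : ℕ) (hs : s ≤ T) :
    Continuous fun x =>
      raJ T (fun t => ℓ t (ctraj f γ s x t)) (fun t => g t (ctraj f γ s x t)) s hs :=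
  continuous_raJ (fun t => (hℓ t).comp (continuous_ctraj hf s t))
    (fun t => (hg t).comp (continuous_ctraj hf s t)) T s hs

/-- If the closed-loop maps of `γ*` and `γ` are continuous, the margin functions
are continuous, and `γ*` is no worse than `γ` from `(s, x*)`, then for every
`ε > 0` there is a `δ > 0` such that `γ*` is `ε`-near-optimal against `γ` from
every initial state in the `δ`-ball around `x*` — the inequality of local strong
time consistency. -/
theorem optimality_extends_to_eps_near_optimality_on_ball
    {X U : Type*} [MetricSpace X]
    (f : ℕ → X → U → X) (γstar γ : ℕ → X → U)
    (hfstar : ∀ t, Continuous fun x => f t x (γstar t x))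
    (hfγ : ∀ t, Continuous fun x => f t x (γ t x))
    (ℓ g : ℕ → X → ℝ)
    (hℓ : ∀ t, Continuous (ℓ t)) (hg : ∀ t, Continuous (g t))
    (T : ℕ) (s : ℕ) (hs : s ≤ T) (xstar : X)
    (hopt : raJ T (fun t => ℓ t (ctraj f γstar s xstar t))
                  (fun t => g t (ctraj f γstar s xstar t)) s hs ≤
            raJ T (fun t => ℓ t (ctraj f γ s xstar t))
                  (fun t => g t (ctraj f γ s xstar t)) s hs) :
    ∀ ε > (0 : ℝ), ∃ δ > (0 : ℝ), ∀ xtilde : X, dist xtilde xstar < δ →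
      raJ T (fun t => ℓ t (ctraj f γstar s xtilde t))
            (fun t => g t (ctraj f γstar s xtilde t)) s hs ≤
        raJ T (fun t => ℓ t (ctraj f γ s xtilde t))
              (fun t => g t (ctraj f γ s xtilde t)) s hs + ε := by
  intro ε hε
  have hlt := (continuous_raJ_ctraj hfstar hℓ hg T s hs).continuousAt.eventually_lt
    ((continuous_raJ_ctraj hfγ hℓ hg T s hs).add_const ε).continuousAt
    (lt_of_le_of_lt hopt (lt_add_of_pos_right _ hε))
  obtain ⟨δ, hδ, h⟩ := Metric.eventually_nhds_iff.mp hlt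
  exact ⟨δ, hδ, fun x hx => (h hx).le⟩
end
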